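/- Let R be a Noetherian local ring and let S = R[x_1,...,x_n]_q be a localization of a polynomial ring at a prime q, and I ⊆ S an ideal generated by a regular sequence of length c with S/I ≅ R' for a fixed R-algebra R'. Then n − c depends only on the R-algebra R' and not on the presentation; in fact n − c = dim R' − dim R when R and R' are regular local with R' essentially of finite type over R via a flat-free situation, or more simply: for two presentations (n, c) and (n', c') one has n − c = n' − c'. -/

import Mathlib

open RingTheory.Sequence

/-- The kernel of a surjection from a polynomial ring onto a field that is already surjective on
constants has height `m` more than the kernel on constants. -/
theorem vd_height_aux {K : Type} [Field K] {S : Type} [CommRing S] [IsNoetherianRing S]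
    (m : ℕ) (f : MvPolynomial (Fin m) S →+* K)
    (hf : Function.Surjective (f.comp MvPolynomial.C)) :
    (RingHom.ker f).height = (RingHom.ker (f.comp MvPolynomial.C)).height + m := by
  induction m with
  | zero =>
    have h := RingEquiv.height_comap (MvPolynomial.isEmptyRingEquiv S (Fin 0)).symm (RingHom.ker f)
    rw [← h]
    simp only [Nat.cast_zero, add_zero]
    congr 1
  | succ m ih =>
    let e := (MvPolynomial.finSuccEquiv S m).toRingEquiv
    let g : Polynomial (MvPolynomial (Fin m) S) →+* K := f.comp (e.symm : _ →+* _)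
    have he : ∀ s, e.symm (Polynomial.C (MvPolynomial.C s)) = MvPolynomial.C s := by
      intro s
      rw [RingEquiv.symm_apply_eq]
      simp [e, MvPolynomial.finSuccEquiv_apply]
    have hgC : (g.comp Polynomial.C).comp MvPolynomial.C = f.comp MvPolynomial.C := by
      ext s
      simp [g, he]
    have hg1 : Function.Surjective (g.comp Polynomial.C) := by
      intro k
      obtain ⟨s, hs⟩ := hf k
      exact ⟨MvPolynomial.C s, by rw [← hs, ← hgC]; rfl⟩
    have hg : Function.Surjective g := by
      intro k
      obtain ⟨s, hs⟩ := hg1 k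
      exact ⟨Polynomial.C s, hs⟩
    have i1 : (RingHom.ker g).IsMaximal := RingHom.ker_isMaximal_of_surjective g hg
    have i2 : (RingHom.ker g).LiesOver (RingHom.ker (g.comp Polynomial.C)) := ⟨by
      ext x; simp [RingHom.mem_ker, Ideal.under]⟩
    have h1 := Polynomial.height_eq_height_add_one (RingHom.ker (g.comp Polynomial.C))
      (RingHom.ker g)
    have h2 := ih (g.comp Polynomial.C) (by rw [hgC]; exact hf)
    have h3 : (RingHom.ker g).height = (RingHom.ker f).height :=
      RingEquiv.height_comap e.symm (RingHom.ker f)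
    rw [← h3, h1, h2, hgC]
    push_cast
    rw [add_assoc]

attribute [local instance] MvPolynomial.algebraMvPolynomial in
theorem vd_height_under {P A K : Type} [CommRing P] [CommRing A] [Algebra P A] [Field K]
    (M : Submonoid P) [IsLocalization M A] (m : ℕ) (f : MvPolynomial (Fin m) A →+* K) :
    (RingHom.ker (f.comp (MvPolynomial.map (algebraMap P A)))).height = (RingHom.ker f).height := by
  have h2 : ((RingHom.ker f).under (MvPolynomial (Fin m) P)).height =
      (RingHom.ker f).height :=
    IsLocalization.height_under (M.map (MvPolynomial.C (σ := Fin m))) _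
  exact h2

theorem vd_height_localization {K R : Type} [Field K] [CommRing R] [IsNoetherianRing R]
    (n m : ℕ) (q : Ideal (MvPolynomial (Fin n) R)) [q.IsPrime]
    (ψ : Localization.AtPrime q →+* K) (hψ : Function.Surjective ψ) (v : Fin m → K)
    (F : MvPolynomial (Fin m ⊕ Fin n) R →+* K)
    (hF : ∀ r, F (MvPolynomial.C r) =
      ψ (algebraMap (MvPolynomial (Fin n) R) _ (MvPolynomial.C r)))
    (hFl : ∀ i, F (MvPolynomial.X (Sum.inl i)) = v i)
    (hFr : ∀ i, F (MvPolynomial.X (Sum.inr i)) =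
      ψ (algebraMap (MvPolynomial (Fin n) R) _ (MvPolynomial.X i))) :
    ((RingHom.ker F).height : WithBot ℕ∞) = ringKrullDim (Localization.AtPrime q) + m := by
  have : IsNoetherianRing (Localization.AtPrime q) :=
    IsLocalization.isNoetherianRing q.primeCompl _ inferInstance
  let f : MvPolynomial (Fin m) (Localization.AtPrime q) →+* K := MvPolynomial.eval₂Hom ψ v
  have hfC : f.comp MvPolynomial.C = ψ := by ext x <;> simp [f]
  have h1 := vd_height_aux m f (by rw [hfC]; exact hψ)
  rw [hfC] at h1
  have i1 : (RingHom.ker ψ).IsMaximal := RingHom.ker_isMaximal_of_surjective ψ hψ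
  rw [IsLocalRing.eq_maximalIdeal i1] at h1
  rw [← IsLocalRing.maximalIdeal_height_eq_ringKrullDim]
  have h2 := vd_height_under (P := MvPolynomial (Fin n) R) q.primeCompl m f
  have h3 := RingEquiv.height_comap (MvPolynomial.sumAlgEquiv R (Fin m) (Fin n)).toRingEquiv
    (RingHom.ker (f.comp (MvPolynomial.map (algebraMap (MvPolynomial (Fin n) R) _))))
  have h4 : F = (f.comp (MvPolynomial.map (algebraMap (MvPolynomial (Fin n) R) _))).comp
      (MvPolynomial.sumAlgEquiv R (Fin m) (Fin n)).toRingEquiv.toRingHom := by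
    apply MvPolynomial.ringHom_ext
    · intro r
      rw [hF]
      simp [f]
    · rintro (i | i)
      · rw [hFl]
        simp [f]
      · rw [hFr]
        simp [f]
  have h5 : RingHom.ker F = Ideal.comap (MvPolynomial.sumAlgEquiv R (Fin m) (Fin n)).toRingEquiv
      (RingHom.ker (f.comp (MvPolynomial.map (algebraMap (MvPolynomial (Fin n) R) _)))) := by
    rw [h4]
    ext z
    simp only [RingHom.mem_ker, Ideal.mem_comap, RingHom.comp_apply]
    exact Iff.rfl
  rw [h5, h3, h2, h1]
  push_cast
  rfl

theorem vd_dim {R R' : Type} [CommRing R] [IsNoetherianRing R] [CommRing R'] [Algebra R R']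
    (n : ℕ) (q : Ideal (MvPolynomial (Fin n) R)) [q.IsPrime]
    (φ : Localization.AtPrime q →ₐ[R] R') (hφ : Function.Surjective φ)
    (as : List (Localization.AtPrime q))
    (hreg : IsRegular (Localization.AtPrime q) as)
    (hker : Ideal.span {r | r ∈ as} = RingHom.ker φ) :
    ringKrullDim R' + as.length = ringKrullDim (Localization.AtPrime q) := by
  have : IsNoetherianRing (Localization.AtPrime q) :=
    IsLocalization.isNoetherianRing q.primeCompl _ inferInstance
  rw [← ringKrullDim_add_length_eq_ringKrullDim_of_isRegular as hreg]
  congr 1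
  have h : Ideal.ofList as = RingHom.ker φ.toRingHom := hker
  rw [h]
  exact (ringKrullDim_eq_of_ringEquiv
    (RingHom.quotientKerEquivOfSurjective (f := φ.toRingHom) hφ)).symm

/-- Well-definedness of the relative virtual dimension: if an `R`-algebra `R'`
admits two presentations as a quotient of a localization of a polynomial ring
`R[x_1, ..., x_n]` at a prime, with kernel generated by a regular sequence of
length `c`, respectively `n'` variables and a regular sequence of length `c'`,
then `n - c = n' - c'`. -/
theorem virtual_dimension_well_defined
    (R R' : Type) [CommRing R] [IsNoetherianRing R] [IsLocalRing R]
    [CommRing R'] [Algebra R R']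
    (n c n' c' : ℕ)
    (q : Ideal (MvPolynomial (Fin n) R)) (hq : q.IsPrime)
    (φ : Localization.AtPrime q →ₐ[R] R') (hφ : Function.Surjective φ)
    (as : List (Localization.AtPrime q)) (hlen : as.length = c)
    (hreg : IsRegular (Localization.AtPrime q) as)
    (hker : Ideal.span {r | r ∈ as} = RingHom.ker φ)
    (q' : Ideal (MvPolynomial (Fin n') R)) (hq' : q'.IsPrime)
    (φ' : Localization.AtPrime q' →ₐ[R] R') (hφ' : Function.Surjective φ')
    (as' : List (Localization.AtPrime q')) (hlen' : as'.length = c')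
    (hreg' : IsRegular (Localization.AtPrime q') as')
    (hker' : Ideal.span {r | r ∈ as'} = RingHom.ker φ') :
    (n : ℤ) - (c : ℤ) = (n' : ℤ) - (c' : ℤ) := by 
  subst hlen hlen'
  have hd := vd_dim n q φ hφ as hreg hker
  have hd' := vd_dim n' q' φ' hφ' as' hreg' hker'
  have hnt : Nontrivial R' := by
    rw [← not_subsingleton_iff_nontrivial]
    intro hs
    have h1 : Ideal.ofList as = ⊤ := by
      refine hker.trans ?_
      rw [eq_top_iff]
      intro x _
      exact Subsingleton.elim _ _
    apply hreg.top_ne_smul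
    rw [h1]
    simp
  obtain ⟨M, hM⟩ := Ideal.exists_maximal R'
  let _ : Field (R' ⧸ M) := Ideal.Quotient.field M
  let π : R' →ₐ[R] R' ⧸ M := Ideal.Quotient.mkₐ R M
  have hπ : Function.Surjective π := Ideal.Quotient.mkₐ_surjective R M
  let x : Fin n → R' ⧸ M := fun i => π (φ (algebraMap (MvPolynomial (Fin n) R) _ (MvPolynomial.X i)))
  let y : Fin n' → R' ⧸ M := fun i => π (φ' (algebraMap (MvPolynomial (Fin n') R) _ (MvPolynomial.X i)))
  let F : MvPolynomial (Fin n' ⊕ Fin n) R →ₐ[R] R' ⧸ M := MvPolynomial.aeval (Sum.elim y x)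
  let F' : MvPolynomial (Fin n ⊕ Fin n') R →ₐ[R] R' ⧸ M := MvPolynomial.aeval (Sum.elim x y)
  have hC : ∀ (r : R), algebraMap (MvPolynomial (Fin n) R) (Localization.AtPrime q)
      (MvPolynomial.C r) = algebraMap R _ r := fun r =>
    (IsScalarTower.algebraMap_apply R (MvPolynomial (Fin n) R) _ r).symm
  have hC' : ∀ (r : R), algebraMap (MvPolynomial (Fin n') R) (Localization.AtPrime q')
      (MvPolynomial.C r) = algebraMap R _ r := fun r =>
    (IsScalarTower.algebraMap_apply R (MvPolynomial (Fin n') R) _ r).symm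
  have h1 := vd_height_localization n n' q (π.comp φ).toRingHom (hπ.comp hφ) y F.toRingHom
    (by intro r; rw [hC]; simp [F])
    (by intro i; simp [F]) (by intro i; simp [F, x])
  have h2 := vd_height_localization n' n q' (π.comp φ').toRingHom (hπ.comp hφ') x F'.toRingHom
    (by intro r; rw [hC']; simp [F'])
    (by intro i; simp [F']) (by intro i; simp [F', y])
  let e := (MvPolynomial.renameEquiv R (Equiv.sumComm (Fin n') (Fin n))).toRingEquiv
  have h3 := RingEquiv.height_comap e (RingHom.ker F'.toRingHom)
  have h4 : F = F'.comp (MvPolynomial.renameEquiv R (Equiv.sumComm (Fin n') (Fin n))).toAlgHom := by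
    apply MvPolynomial.algHom_ext
    rintro (i | i) <;> simp [F, F']
  have h5 : RingHom.ker F.toRingHom = Ideal.comap e (RingHom.ker F'.toRingHom) := by
    rw [h4]
    rfl
  rw [h5, h3, h2, ← hd, ← hd'] at h1
  have i1 : (RingHom.ker F'.toRingHom).IsPrime := RingHom.ker_isPrime F'.toRingHom
  have hfin : (RingHom.ker F'.toRingHom).height ≠ ⊤ := Ideal.height_ne_top i1.ne_top
  rw [← hd'] at h2
  have hbot : ringKrullDim R' ≠ ⊥ := by
    intro h
    have h0 := ringKrullDim_nonneg_of_nontrivial (R := R')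
    rw [h] at h0
    simp at h0
  revert h1 h2
  generalize ringKrullDim R' = d at *
  generalize (RingHom.ker F'.toRingHom).height = t at *
  intro h2 h1
  induction d with
  | bot => exact absurd rfl hbot
  | coe d =>
    induction d with
    | top =>
      exfalso
      apply hfin
      have h6 : ((⊤ + as'.length + n : ℕ∞) : WithBot ℕ∞) = (t : WithBot ℕ∞) := by
        rw [h2]; push_cast; rfl
      have h7 := WithBot.coe_injective h6
      simpa using h7.symm
    | coe d =>
      have h6 : d + as'.length + n = d + as.length + n' := by exact_mod_cast h1
      omega
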